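/- arXiv:2103.10606 — 7 statements merged into one kernel-verified Lean document; each statement's English description precedes it below -/
import Mathlib

section
/- Let n ≥ 1, let A be a real symmetric positive definite n×n matrix, let a ∈ ℝⁿ satisfy aᵀA⁻¹a < 1, let c > 0 and let y ∈ ℝⁿ. Then the matrix Σ = c·(A − aaᵀ) is symmetric positive definite, and the multivariate Gaussian density of N(0, Σ) evaluated at y factorizes as (2π)^{−n/2} det(Σ)^{−1/2} exp(−yᵀΣ⁻¹y/2) = (2πc)^{−n/2} det(A)^{−1/2} exp(−yᵀA⁻¹y/(2c)) · (1 − aᵀA⁻¹a)^{−1/2} · exp(−(aᵀA⁻¹y)² / (2c(1 − aᵀA⁻¹a))). -/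
open Matrix

namespace Matrix

section Field

variable {ι K : Type*} [Fintype ι] [DecidableEq ι] [Field K]

/-- Matrix determinant lemma for subtracting an outer product. -/
theorem det_sub_vecMulVec {A : Matrix ι ι K} (hA : IsUnit A.det) (u v : ι → K) :
    (A - vecMulVec u v).det = A.det * (1 - v ⬝ᵥ A⁻¹ *ᵥ u) := by
  have h := det_add_replicateCol_mul_replicateRow (ι := Unit) hA (-u) v
  rw [← vecMulVec_eq, neg_vecMulVec, ← sub_eq_add_neg] at h
  rw [h, det_unique (n := Unit), add_apply, one_apply_eq, Matrix.mul_assoc, ← replicateCol_mulVec,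
    replicateRow_mul_replicateCol_apply, mulVec_neg, dotProduct_neg, ← sub_eq_add_neg]

/-- Sherman–Morrison formula for subtracting an outer product, applied to a vector. -/
theorem inv_sub_vecMulVec_mulVec {A : Matrix ι ι K} (hA : IsUnit A.det) {u v : ι → K}
    (huv : 1 - v ⬝ᵥ A⁻¹ *ᵥ u ≠ 0) (y : ι → K) :
    (A - vecMulVec u v)⁻¹ *ᵥ y =
      A⁻¹ *ᵥ y + ((v ⬝ᵥ A⁻¹ *ᵥ y) / (1 - v ⬝ᵥ A⁻¹ *ᵥ u)) • (A⁻¹ *ᵥ u) := by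
  set w := A⁻¹ *ᵥ y + ((v ⬝ᵥ A⁻¹ *ᵥ y) / (1 - v ⬝ᵥ A⁻¹ *ᵥ u)) • (A⁻¹ *ᵥ u) with hw
  have hdet : IsUnit (A - vecMulVec u v).det := by
    rw [det_sub_vecMulVec hA]
    exact hA.mul huv.isUnit
  have key : (A - vecMulVec u v) *ᵥ w = y := by
    have hcancel (z : ι → K) : A *ᵥ (A⁻¹ *ᵥ z) = z := by
      rw [mulVec_mulVec, mul_nonsing_inv A hA, one_mulVec]
    ext i
    simp only [hw, sub_mulVec, mulVec_add, mulVec_smul, hcancel, vecMulVec_mulVec, Pi.sub_apply,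
      Pi.add_apply, Pi.smul_apply, smul_eq_mul, MulOpposite.smul_eq_mul_unop,
      MulOpposite.unop_op]
    field_simp
    ring
  rw [← key, mulVec_mulVec, nonsing_inv_mul _ hdet, one_mulVec]

end Field

variable {ι : Type*} [Fintype ι]

/-- Real symmetric matrices can be moved across the dot product. -/
theorem IsHermitian.dotProduct_mulVec_comm {A : Matrix ι ι ℝ} (hA : A.IsHermitian)
    (x y : ι → ℝ) : x ⬝ᵥ A *ᵥ y = y ⬝ᵥ A *ᵥ x := by
  have h : Aᵀ = A := by simpa [IsHermitian, conjTranspose_eq_transpose_of_trivial] using hA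
  rw [dotProduct_mulVec, ← mulVec_transpose, h, dotProduct_comm]

theorem PosDef.sub_vecMulVec_self [DecidableEq ι] {A : Matrix ι ι ℝ} (hA : A.PosDef) {a : ι → ℝ}
    (ha : a ⬝ᵥ A⁻¹ *ᵥ a < 1) : (A - vecMulVec a a).PosDef := by
  have hdet : IsUnit A.det := (isUnit_iff_isUnit_det A).1 hA.isUnit
  have hvec : (vecMulVec a a).IsHermitian := by
    simpa using (posSemidef_vecMulVec_self_star a).isHermitian
  refine .of_dotProduct_mulVec_pos (hA.isHermitian.sub hvec) fun x hx => ?_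
  have hquad : x ⬝ᵥ (A - vecMulVec a a) *ᵥ x = x ⬝ᵥ A *ᵥ x - (a ⬝ᵥ x) ^ 2 := by
    simp [sub_mulVec, vecMulVec_mulVec, dotProduct_sub, dotProduct_smul, dotProduct_comm x a, sq]
  rw [star_trivial, hquad]
  have hxx : 0 < x ⬝ᵥ A *ᵥ x := by simpa using hA.dotProduct_mulVec_pos hx
  have hAb : A *ᵥ (A⁻¹ *ᵥ a) = a := by
    rw [mulVec_mulVec, mul_nonsing_inv A hdet, one_mulVec]
  have hz : 0 ≤ (x - (a ⬝ᵥ x) • (A⁻¹ *ᵥ a)) ⬝ᵥ A *ᵥ (x - (a ⬝ᵥ x) • (A⁻¹ *ᵥ a)) := by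
    simpa using hA.posSemidef.dotProduct_mulVec_nonneg (x - (a ⬝ᵥ x) • (A⁻¹ *ᵥ a))
  have hbx : (A⁻¹ *ᵥ a) ⬝ᵥ A *ᵥ x = a ⬝ᵥ x := by
    rw [hA.isHermitian.dotProduct_mulVec_comm, hAb, dotProduct_comm]
  simp only [mulVec_sub, mulVec_smul, hAb, sub_dotProduct, dotProduct_sub, smul_dotProduct,
    dotProduct_smul, hbx, smul_eq_mul, dotProduct_comm x a, dotProduct_comm (A⁻¹ *ᵥ a) a] at hz
  rcases eq_or_ne (a ⬝ᵥ x) 0 with h | h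
  · simpa [h] using hxx
  · have : 0 < (a ⬝ᵥ x) ^ 2 * (1 - a ⬝ᵥ A⁻¹ *ᵥ a) := mul_pos (by positivity) (by linarith)
    nlinarith

end Matrix

/-- Matrix form of Proposition 1: for `A` symmetric positive definite, `a` with
`aᵀ A⁻¹ a < 1`, `c > 0` and `y ∈ ℝⁿ`, the matrix `Σ = c • (A - a aᵀ)` is symmetric
positive definite, and the `N(0, Σ)` Gaussian density at `y` factorizes as stated. -/
theorem gaussian_density_rank_one_factorization {n : ℕ} (hn : 1 ≤ n)
    (A : Matrix (Fin n) (Fin n) ℝ) (hA : A.PosDef)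
    (a : Fin n → ℝ) (ha : a ⬝ᵥ A⁻¹ *ᵥ a < 1) (c : ℝ) (hc : 0 < c) (y : Fin n → ℝ) :
    (c • (A - Matrix.vecMulVec a a)).PosDef ∧
      (2 * Real.pi) ^ (-(n : ℝ) / 2) *
          (c • (A - Matrix.vecMulVec a a)).det ^ (-(1 : ℝ) / 2) *
          Real.exp (-(y ⬝ᵥ (c • (A - Matrix.vecMulVec a a))⁻¹ *ᵥ y) / 2) =
        (2 * Real.pi * c) ^ (-(n : ℝ) / 2) * A.det ^ (-(1 : ℝ) / 2) *
          Real.exp (-(y ⬝ᵥ A⁻¹ *ᵥ y) / (2 * c)) *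
          (1 - a ⬝ᵥ A⁻¹ *ᵥ a) ^ (-(1 : ℝ) / 2) *
          Real.exp (-(a ⬝ᵥ A⁻¹ *ᵥ y) ^ 2 / (2 * c * (1 - a ⬝ᵥ A⁻¹ *ᵥ a))) := by
  have hdet : IsUnit A.det := (isUnit_iff_isUnit_det A).1 hA.isUnit
  have hs : 0 < 1 - a ⬝ᵥ A⁻¹ *ᵥ a := sub_pos.2 ha
  have hB : (A - vecMulVec a a).PosDef := hA.sub_vecMulVec_self ha
  refine ⟨hB.smul hc, ?_⟩
  have hdetS : (c • (A - vecMulVec a a)).det ^ (-(1 : ℝ) / 2) =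
      c ^ (-(n : ℝ) / 2) * A.det ^ (-(1 : ℝ) / 2) *
        (1 - a ⬝ᵥ A⁻¹ *ᵥ a) ^ (-(1 : ℝ) / 2) := by
    rw [det_smul, Fintype.card_fin, det_sub_vecMulVec hdet,
      Real.mul_rpow (by positivity) (mul_pos hA.det_pos hs).le,
      Real.mul_rpow hA.det_pos.le hs.le, ← Real.rpow_natCast_mul hc.le, mul_assoc]
    congr 2
    ring
  have hinv : (c • (A - vecMulVec a a))⁻¹ = c⁻¹ • (A - vecMulVec a a)⁻¹ :=
    inv_smul' (A - vecMulVec a a) (Units.mk0 c hc.ne') hB.det_pos.ne'.isUnit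
  have hexp : -(y ⬝ᵥ (c • (A - vecMulVec a a))⁻¹ *ᵥ y) / 2 =
      -(y ⬝ᵥ A⁻¹ *ᵥ y) / (2 * c) +
        -(a ⬝ᵥ A⁻¹ *ᵥ y) ^ 2 / (2 * c * (1 - a ⬝ᵥ A⁻¹ *ᵥ a)) := by
    rw [hinv, smul_mulVec, inv_sub_vecMulVec_mulVec hdet hs.ne', dotProduct_smul, dotProduct_add,
      dotProduct_smul, hA.inv.isHermitian.dotProduct_mulVec_comm y a, smul_eq_mul, smul_eq_mul]
    field_simp
    ring
  rw [hdetS, hexp, Real.exp_add, Real.mul_rpow (by positivity) hc.le]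
  ring
end

section
/- Let f₀ : ℝ → ℝ be twice continuously differentiable on [0,1], and let t ∈ (0,1) satisfy f₀′(t) = 0 and f₀″(t) ≠ 0. Then there exist constants ε₀ > 0 and C > 0 such that for every ε ∈ (0, ε₀] and every twice continuously differentiable function g : ℝ → ℝ satisfying sup_{x∈[0,1]} |g′(x) − f₀′(x)| ≤ ε and sup_{x∈[0,1]} |g″(x) − f₀″(x)| ≤ ε₀, there exists s ∈ (0,1) with g′(s) = 0, |s − t| ≤ C·ε, and g″(s)·f₀″(t) > 0 (so s is a local extremum of g of the same type as t is for f₀). -/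
/-- A function whose derivative is at least `m` on `[t - r, t + r]` and whose value at `t` is at
most `m * r` in absolute value vanishes somewhere on `[t - r, t + r]`. -/
theorem exists_zero_of_le_deriv {φ : ℝ → ℝ} (hφ : Differentiable ℝ φ) {t r m : ℝ} (hr : 0 ≤ r)
    (hm : ∀ x ∈ Set.Icc (t - r) (t + r), m ≤ deriv φ x) (ht : |φ t| ≤ m * r) :
    ∃ s ∈ Set.Icc (t - r) (t + r), φ s = 0 := by
  have growth := (convex_Icc (t - r) (t + r)).mul_sub_le_image_sub_of_le_deriv
    hφ.continuous.continuousOn hφ.differentiableOn fun x hx => hm x (interior_subset hx)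
  have left := growth (t - r) ⟨le_rfl, by linarith⟩ t ⟨by linarith, by linarith⟩ (by linarith)
  have right := growth t ⟨by linarith, by linarith⟩ (t + r) ⟨by linarith, le_rfl⟩ (by linarith)
  obtain ⟨h₁, h₂⟩ := abs_le.mp ht
  exact intermediate_value_Icc (by linarith) hφ.continuous.continuousOn
    ⟨by linarith, by linarith⟩

/-- Deterministic content of Lemma 3: near a nondegenerate local extremum `t` of `f₀`,
every twice continuously differentiable function `g` whose first derivative is uniformly
`ε`-close and whose second derivative is uniformly `ε₀`-close to those of `f₀` on `[0,1]`
has a critical point `s` with `|s - t| ≤ C ε` and with second derivative of the same sign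
as `f₀''(t)`. -/
theorem local_extremum_stability
    (f₀ : ℝ → ℝ) (hf₀ : ContDiff ℝ 2 f₀) (t : ℝ) (ht : t ∈ Set.Ioo (0 : ℝ) 1)
    (h1 : deriv f₀ t = 0) (h2 : deriv (deriv f₀) t ≠ 0) :
    ∃ ε₀ > (0 : ℝ), ∃ C > (0 : ℝ), ∀ ε ∈ Set.Ioc (0 : ℝ) ε₀, ∀ g : ℝ → ℝ,
      ContDiff ℝ 2 g →
      (∀ x ∈ Set.Icc (0 : ℝ) 1, |deriv g x - deriv f₀ x| ≤ ε) →
      (∀ x ∈ Set.Icc (0 : ℝ) 1, |deriv (deriv g) x - deriv (deriv f₀) x| ≤ ε₀) →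
      ∃ s ∈ Set.Ioo (0 : ℝ) 1, deriv g s = 0 ∧ |s - t| ≤ C * ε ∧
        deriv (deriv g) s * deriv (deriv f₀) t > 0 := by
  have hf₀'' : Continuous (deriv (deriv f₀)) := by
    simpa [iteratedDeriv_succ, iteratedDeriv_zero] using hf₀.continuous_iteratedDeriv 2 le_rfl
  set c := deriv (deriv f₀) t with hc
  have hc_pos : 0 < |c| := abs_pos.mpr h2
  obtain ⟨δ, hδ, hball⟩ : ∃ δ > 0, Metric.closedBall t δ ⊆
      {x | |deriv (deriv f₀) x - c| < |c| / 4} ∩ Set.Ioo 0 1 := by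
    refine Metric.nhds_basis_closedBall.mem_iff.mp (Filter.inter_mem ?_ (isOpen_Ioo.mem_nhds ht))
    refine (isOpen_lt (hf₀''.sub continuous_const).abs continuous_const).mem_nhds ?_
    simpa [← hc] using h2
  refine ⟨min (|c| / 4) (δ * |c| / 2), by positivity, 2 / |c|, by positivity, ?_⟩
  rintro ε ⟨hε, hε₀⟩ g hg hg' hg''
  have hrδ : 2 / |c| * ε ≤ δ := by
    have := hε₀.trans (min_le_right _ _)
    rw [div_mul_eq_mul_div, div_le_iff₀ hc_pos]
    linarith
  have hsub : ∀ x ∈ Set.Icc (t - 2 / |c| * ε) (t + 2 / |c| * ε), x ∈ Metric.closedBall t δ := by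
    intro x hx
    rw [Real.closedBall_eq_Icc]
    exact ⟨by linarith [hx.1], by linarith [hx.2]⟩
  have hderiv : ∀ x ∈ Metric.closedBall t δ, c ^ 2 / 2 ≤ c * deriv (deriv g) x := by
    intro x hx
    obtain ⟨hx₁, hx₂⟩ := hball hx
    have hclose : |deriv (deriv g) x - c| ≤ |c| / 2 := by
      have := (hg'' x (Set.Ioo_subset_Icc_self hx₂)).trans (min_le_left _ _)
      have := abs_sub_le (deriv (deriv g) x) (deriv (deriv f₀) x) c
      have : |deriv (deriv f₀) x - c| < |c| / 4 := hx₁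
      linarith
    have hprod : |c * (deriv (deriv g) x - c)| ≤ |c| * (|c| / 2) := by
      rw [abs_mul]
      gcongr
    linarith [(abs_le.mp hprod).1, abs_mul_abs_self c]
  have hdiff : Differentiable ℝ (deriv g) := by
    simpa [iteratedDeriv_one] using hg.differentiable_iteratedDeriv 1 (by norm_num)
  obtain ⟨s, hs, hs₀⟩ := exists_zero_of_le_deriv (φ := fun x => c * deriv g x) (m := c ^ 2 / 2)
    (t := t) (r := 2 / |c| * ε) (hdiff.const_mul c) (by positivity)
    (fun x hx => by
      rw [deriv_const_mul _ (hdiff x)]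
      exact hderiv x (hsub x hx))
    (by
      have hgt : |deriv g t| ≤ ε := by simpa [h1] using hg' t (Set.Ioo_subset_Icc_self ht)
      calc |c * deriv g t| ≤ |c| * ε := by rw [abs_mul]; gcongr
        _ = c ^ 2 / 2 * (2 / |c| * ε) := by rw [← sq_abs c]; field_simp)
  refine ⟨s, (hball (hsub s hs)).2, (mul_eq_zero.mp hs₀).resolve_left h2, ?_, ?_⟩
  · exact abs_le.mpr ⟨by linarith [hs.1], by linarith [hs.2]⟩
  · have : 0 < c ^ 2 := by positivity
    linarith [hderiv s (hsub s hs)]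
end

section
/- Let γ > 0 and let k be a nonnegative integer with k < eγ, where e is Euler's number. Then for every λ > 0 and every integer i ≥ 1, λ^{1/2 + k/(2eγ)} · i^k · e^{−γ i} ≤ λ + e^{−2γ i}. -/
/-- The tangent line of `x ↦ exp (x / e)` at `x = e` is the identity. -/
theorem Real.le_exp_div_exp_one (x : ℝ) : x ≤ Real.exp (x / Real.exp 1) := by
  have h := Real.add_one_le_exp (x / Real.exp 1 - 1)
  rwa [sub_add_cancel, Real.exp_sub, div_le_div_iff_of_pos_right (Real.exp_pos 1)] at h

/-- Weighted AM-GM without the weights on the right-hand side. -/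
theorem Real.rpow_mul_rpow_one_sub_le_add {θ a b : ℝ} (hθ₀ : 0 ≤ θ) (hθ₁ : θ ≤ 1)
    (ha : 0 ≤ a) (hb : 0 ≤ b) : a ^ θ * b ^ (1 - θ) ≤ a + b :=
  calc a ^ θ * b ^ (1 - θ) ≤ θ * a + (1 - θ) * b :=
        Real.geom_mean_le_arith_mean2_weighted hθ₀ (sub_nonneg.2 hθ₁) ha hb
          (add_sub_cancel θ 1)
    _ ≤ a + b := add_le_add (mul_le_of_le_one_left ha hθ₁)
        (mul_le_of_le_one_left hb (sub_le_self 1 hθ₀))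

/-- Pointwise Young-type inequality from the proof of Lemma 4: for `γ > 0`, a nonnegative
integer `k < eγ`, every `λ > 0` and every integer `i ≥ 1`,
`λ^{1/2 + k/(2eγ)} · iᵏ · e^{-γi} ≤ λ + e^{-2γi}`. -/
theorem young_pointwise_exponential_eigenvalues
    (γ : ℝ) (hγ : 0 < γ) (k : ℕ) (hk : (k : ℝ) < Real.exp 1 * γ) :
    ∀ lam : ℝ, 0 < lam → ∀ i : ℕ, 1 ≤ i →
      lam ^ ((1 : ℝ) / 2 + (k : ℝ) / (2 * Real.exp 1 * γ)) * (i : ℝ) ^ k *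
          Real.exp (-γ * (i : ℝ)) ≤
        lam + Real.exp (-2 * γ * (i : ℝ)) := by
  intro lam hlam i _
  have he := Real.exp_pos 1
  set θ : ℝ := (1 : ℝ) / 2 + (k : ℝ) / (2 * Real.exp 1 * γ) with hθ
  have hθ₀ : 0 ≤ θ := by positivity
  have hθ₁ : θ ≤ 1 := by
    have : (k : ℝ) / (2 * Real.exp 1 * γ) ≤ 1 / 2 := by
      rw [div_le_iff₀ (by positivity)]
      linarith
    linarith
  have hpow : (i : ℝ) ^ k ≤ Real.exp (k * (i / Real.exp 1)) := by
    rw [Real.exp_nat_mul]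
    exact pow_le_pow_left₀ i.cast_nonneg (Real.le_exp_div_exp_one i) k
  calc lam ^ θ * (i : ℝ) ^ k * Real.exp (-γ * i)
      ≤ lam ^ θ * Real.exp (k * (i / Real.exp 1)) * Real.exp (-γ * i) := by gcongr
    _ = lam ^ θ * Real.exp (-2 * γ * i) ^ (1 - θ) := by
        rw [mul_assoc, ← Real.exp_add, ← Real.exp_mul]
        congr 2
        rw [hθ]
        field_simp
        ring
    _ ≤ lam + Real.exp (-2 * γ * i) :=
        Real.rpow_mul_rpow_one_sub_le_add hθ₀ hθ₁ hlam.le (Real.exp_pos _).le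
end

section
/- Let γ > 0 and let k be a nonnegative integer with k < eγ, where e is Euler's number. Then for every λ > 0 and every sequence (f_i)_{i≥1} of real numbers, ∑_{i=1}^∞ (λ/(λ + e^{−2γ i})) · i^k · |f_i| ≤ λ^{1/2 − k/(2eγ)} · ∑_{i=1}^∞ e^{γ i}|f_i|, where both sides are interpreted as values in [0, ∞]. -/
/-- The shrinkage factor `lam / (lam + mu)` is at most `(lam / mu) ^ a` for `a ∈ [0, 1]`. -/
theorem div_add_le_rpow_div_rpow {lam mu a : ℝ} (hlam : 0 < lam) (hmu : 0 < mu)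
    (ha₀ : 0 ≤ a) (ha₁ : a ≤ 1) : lam / (lam + mu) ≤ lam ^ a / mu ^ a := by
  have h := Real.geom_mean_le_arith_mean2_weighted (sub_nonneg.2 ha₁) ha₀ hlam.le hmu.le (by ring)
  have hle : lam ^ (1 - a) * mu ^ a ≤ lam + mu := by nlinarith
  have hsplit : lam ^ a * lam ^ (1 - a) = lam := by
    rw [← Real.rpow_add hlam, add_sub_cancel, Real.rpow_one]
  have hpos : 0 < lam ^ a := Real.rpow_pos_of_pos hlam a
  rw [div_le_div_iff₀ (by positivity) (Real.rpow_pos_of_pos hmu a)]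
  calc lam * mu ^ a = lam ^ a * (lam ^ (1 - a) * mu ^ a) := by rw [← mul_assoc, hsplit]
    _ ≤ lam ^ a * (lam + mu) := by gcongr

theorem pow_le_exp_mul_div_exp_one {x : ℝ} (hx : 0 ≤ x) (k : ℕ) :
    x ^ k ≤ Real.exp (k * (x / Real.exp 1)) := by
  have h : x ≤ Real.exp (x / Real.exp 1) := by
    have h := Real.add_one_le_exp (x / Real.exp 1 - 1)
    rwa [sub_add_cancel, Real.exp_sub, div_le_div_iff_of_pos_right (Real.exp_pos 1)] at h
  rw [Real.exp_nat_mul]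
  gcongr

theorem shrinkage_mul_pow_le {γ lam x : ℝ} {k : ℕ} (hγ : 0 < γ) (hk : (k : ℝ) ≤ Real.exp 1 * γ)
    (hlam : 0 < lam) (hx : 0 ≤ x) :
    lam / (lam + Real.exp (-2 * γ * x)) * x ^ k ≤
      lam ^ ((1 : ℝ) / 2 - (k : ℝ) / (2 * Real.exp 1 * γ)) * Real.exp (γ * x) := by
  have he := Real.exp_pos 1
  set a : ℝ := (1 : ℝ) / 2 - (k : ℝ) / (2 * Real.exp 1 * γ) with ha
  have ha₀ : 0 ≤ a := by
    rw [ha, sub_nonneg, div_le_div_iff₀ (by positivity) two_pos]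
    linarith
  have ha₁ : a ≤ 1 := by
    have : 0 ≤ (k : ℝ) / (2 * Real.exp 1 * γ) := by positivity
    linarith
  have hexp : γ * x = k * (x / Real.exp 1) - -2 * γ * x * a := by
    rw [ha]
    field_simp
    ring
  calc lam / (lam + Real.exp (-2 * γ * x)) * x ^ k
      ≤ lam ^ a / Real.exp (-2 * γ * x) ^ a * Real.exp (k * (x / Real.exp 1)) :=
        mul_le_mul (div_add_le_rpow_div_rpow hlam (Real.exp_pos _) ha₀ ha₁)
          (pow_le_exp_mul_div_exp_one hx k) (by positivity) (by positivity)
    _ = lam ^ a * Real.exp (γ * x) := by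
        rw [hexp, Real.exp_sub, Real.exp_mul (-2 * γ * x) a]
        ring

/-- Analytic core of Lemma 4: for `γ > 0`, a nonnegative integer `k < eγ`, every `λ > 0`
and every sequence `(f_i)_{i ≥ 1}`,
`∑_{i=1}^∞ (λ/(λ + e^{-2γi})) iᵏ |f_i| ≤ λ^{1/2 - k/(2eγ)} ∑_{i=1}^∞ e^{γi} |f_i|`,
with both sides interpreted as values in `[0, ∞]`. -/
theorem series_bound_exponential_eigenvalues
    (γ : ℝ) (hγ : 0 < γ) (k : ℕ) (hk : (k : ℝ) < Real.exp 1 * γ)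
    (lam : ℝ) (hlam : 0 < lam) (f : ℕ → ℝ) :
    ∑' i : ℕ, ENNReal.ofReal
        (lam / (lam + Real.exp (-2 * γ * ((i : ℝ) + 1))) * ((i : ℝ) + 1) ^ k *
          |f (i + 1)|) ≤
      ENNReal.ofReal (lam ^ ((1 : ℝ) / 2 - (k : ℝ) / (2 * Real.exp 1 * γ))) *
        ∑' i : ℕ, ENNReal.ofReal (Real.exp (γ * ((i : ℝ) + 1)) * |f (i + 1)|) := by
  rw [← ENNReal.tsum_mul_left]
  refine ENNReal.tsum_le_tsum fun i => ?_
  rw [← ENNReal.ofReal_mul (by positivity), ← mul_assoc]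
  exact ENNReal.ofReal_le_ofReal (mul_le_mul_of_nonneg_right
    (shrinkage_mul_pow_le hγ hk.le hlam (by positivity)) (abs_nonneg _))
end

section
/- Let γ > 0 and let m be an integer with 1 ≤ m < 2eγ, where e is Euler's number. Then there exists a constant C > 0, depending only on γ and m, such that for every λ ∈ (0,1], ∑_{i=1}^∞ (e^{−2γ i}/(e^{−2γ i} + λ)) · i^m ≤ C · λ^{−m/(2eγ)}. -/
theorem div_add_le_rpow_mul_rpow_neg {a b s : ℝ} (ha : 0 < a) (hb : 0 < b) (hs0 : 0 ≤ s)
    (hs1 : s ≤ 1) : a / (a + b) ≤ a ^ s * b ^ (-s) := by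
  have amgm : a ^ (1 - s) * b ^ s ≤ (1 - s) * a + s * b :=
    Real.geom_mean_le_arith_mean2_weighted (by linarith) hs0 ha.le hb.le (by ring)
  have hle : a ^ (1 - s) * b ^ s ≤ a + b := by nlinarith
  rw [div_le_iff₀ (by positivity)]
  calc a = a ^ s * b ^ (-s) * (a ^ (1 - s) * b ^ s) := by
        rw [mul_mul_mul_comm, ← Real.rpow_add ha, ← Real.rpow_add hb]
        simp
    _ ≤ a ^ s * b ^ (-s) * (a + b) := by gcongr

/-- Summed bound from the proof of Theorem 5 (kernels with exponentially decaying
eigenvalues): for `γ > 0` and an integer `1 ≤ m < 2eγ`, there is a constant `C > 0`,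
depending only on `γ` and `m`, such that for every `λ ∈ (0,1]`,
`∑_{i=1}^∞ (e^{-2γi}/(e^{-2γi} + λ)) iᵐ ≤ C λ^{-m/(2eγ)}`. -/
theorem series_bound_exponential_eigenvalues_sup
    (γ : ℝ) (hγ : 0 < γ) (m : ℕ) (hm1 : 1 ≤ m) (hm : (m : ℝ) < 2 * Real.exp 1 * γ) :
    ∃ C > (0 : ℝ), ∀ lam ∈ Set.Ioc (0 : ℝ) 1,
      ∑' i : ℕ, ENNReal.ofReal
          (Real.exp (-2 * γ * ((i : ℝ) + 1)) /
              (Real.exp (-2 * γ * ((i : ℝ) + 1)) + lam) * ((i : ℝ) + 1) ^ m) ≤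
        ENNReal.ofReal (C * lam ^ (-(m : ℝ) / (2 * Real.exp 1 * γ))) := by
  have hden : 0 < 2 * Real.exp 1 * γ := by positivity
  have hm0 : (0 : ℝ) < m := by exact_mod_cast hm1
  rw [neg_div]
  set s : ℝ := (m : ℝ) / (2 * Real.exp 1 * γ)
  have hs0 : 0 < s := div_pos hm0 hden
  have hs1 : s ≤ 1 := (div_le_one hden).2 hm.le
  let g : ℕ → ℝ := fun i => ((i : ℝ) + 1) ^ m * Real.exp (-(2 * γ * s) * ((i : ℝ) + 1))
  have hg0 : ∀ i, 0 ≤ g i := fun i => by positivity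
  have hg : Summable g := by
    have h := (summable_nat_add_iff 1).2
      (Real.summable_pow_mul_exp_neg_nat_mul m (r := 2 * γ * s) (by positivity))
    simpa [g] using h
  refine ⟨∑' i, g i + 1, add_pos_of_nonneg_of_pos (tsum_nonneg hg0) one_pos, fun lam hlam => ?_⟩
  have hpos : 0 < lam ^ (-s) := Real.rpow_pos_of_pos hlam.1 _
  calc _ ≤ ∑' i : ℕ, ENNReal.ofReal (g i * lam ^ (-s)) := by
        refine ENNReal.tsum_le_tsum fun i => ENNReal.ofReal_le_ofReal ?_
        calc _ ≤ Real.exp (-2 * γ * ((i : ℝ) + 1)) ^ s * lam ^ (-s) * ((i : ℝ) + 1) ^ m := by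
              gcongr
              exact div_add_le_rpow_mul_rpow_neg (Real.exp_pos _) hlam.1 hs0.le hs1
          _ = g i * lam ^ (-s) := by
              rw [← Real.exp_mul, show -2 * γ * ((i : ℝ) + 1) * s
                = -(2 * γ * s) * ((i : ℝ) + 1) by ring]
              ring
    _ = ENNReal.ofReal ((∑' i, g i) * lam ^ (-s)) := by
        rw [← tsum_mul_right, ENNReal.ofReal_tsum_of_nonneg
          (fun i => mul_nonneg (hg0 i) hpos.le) (hg.mul_right _)]
    _ ≤ _ := ENNReal.ofReal_le_ofReal (by gcongr; linarith)
end

section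
/- Let p be a nonnegative integer and let α > (p+1)/2 be a real number. Then there exists a constant C > 0, depending only on α and p, such that for every λ ∈ (0,1], ∑_{i=1}^∞ (i^{−2α}/(i^{−2α} + λ)) · i^p ≤ C · λ^{−(p+1)/(2α)}. -/
/-- On the block of indices `k * M, …, k * M + (M - 1)` with `N ≤ M ≤ 2 * N`, the summand with
regularization `N ^ (-(2 * α))` is at most `N ^ p` times a quantity depending only on `k`. -/
theorem regularized_power_term_le (p : ℕ) {α N : ℝ} (hα : (p : ℝ) < 2 * α) (hN : 1 ≤ N)
    {M : ℕ} (hNM : N ≤ M) (hMN : (M : ℝ) ≤ 2 * N) (k r : ℕ) (hr : r < M) :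
    (((k * M + r : ℕ) : ℝ) + 1) ^ (-(2 * α)) /
        ((((k * M + r : ℕ) : ℝ) + 1) ^ (-(2 * α)) + N ^ (-(2 * α))) *
        (((k * M + r : ℕ) : ℝ) + 1) ^ p ≤
      N ^ p * ((if k = 0 then (2 : ℝ) ^ p else 0) + (k : ℝ) ^ (-(2 * α - p))) := by
  have hN0 : 0 < N := by linarith
  set x : ℝ := ((k * M + r : ℕ) : ℝ) + 1 with hx
  have hx0 : 0 < x := by positivity
  have hxa : 0 < x ^ (-(2 * α)) := Real.rpow_pos_of_pos hx0 _
  have hNa : 0 < N ^ (-(2 * α)) := Real.rpow_pos_of_pos hN0 _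
  rcases Nat.eq_zero_or_pos k with rfl | hk
  · have hxM : x ≤ M := by
      rw [hx]
      have : r + 1 ≤ M := hr
      simpa using (by exact_mod_cast this : (r : ℝ) + 1 ≤ M)
    have h0 : (0 : ℝ) ≤ ((0 : ℕ) : ℝ) ^ (-(2 * α - p)) := by positivity
    calc x ^ (-(2 * α)) / (x ^ (-(2 * α)) + N ^ (-(2 * α))) * x ^ p
        ≤ 1 * x ^ p := by
          gcongr
          exact (div_le_one (by positivity)).2 (by linarith)
      _ ≤ (2 * N) ^ p := by
          rw [one_mul]
          gcongr
          linarith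
      _ = N ^ p * 2 ^ p := by rw [mul_pow, mul_comm]
      _ ≤ _ := by
          gcongr
          simpa using h0
  · have hk0 : (0 : ℝ) < k := by exact_mod_cast hk
    have hkx : k * N ≤ x := by
      have : (k : ℝ) * N ≤ k * M := by gcongr
      rw [hx]
      push_cast
      have : (0 : ℝ) ≤ r := by positivity
      linarith
    rw [if_neg hk.ne', zero_add]
    calc x ^ (-(2 * α)) / (x ^ (-(2 * α)) + N ^ (-(2 * α))) * x ^ p
        ≤ x ^ (-(2 * α)) / N ^ (-(2 * α)) * x ^ p := by
          gcongr
          linarith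
      _ = N ^ (2 * α) * x ^ (-(2 * α - p)) := by
          rw [Real.rpow_neg hN0.le, div_inv_eq_mul,
            show -(2 * α - p) = -(2 * α) + p by ring, Real.rpow_add hx0, Real.rpow_natCast]
          ring
      _ ≤ N ^ (2 * α) * (k * N) ^ (-(2 * α - p)) := by
          gcongr ?_ * ?_
          exact Real.rpow_le_rpow_of_nonpos (by positivity) hkx (by linarith)
      _ = N ^ p * (k : ℝ) ^ (-(2 * α - p)) := by
          have : N ^ (2 * α) * N ^ (-(2 * α - p)) = N ^ p := by
            rw [← Real.rpow_add hN0, ← Real.rpow_natCast]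
            congr 1
            ring
          rw [Real.mul_rpow hk0.le hN0.le, ← this]
          ring

/-- Series estimate from the proof of Theorem 4 (kernels with polynomially decaying
eigenvalues): for a nonnegative integer `p` and a real `α > (p+1)/2`, there is a constant
`C > 0`, depending only on `α` and `p`, such that for every `λ ∈ (0,1]`,
`∑_{i=1}^∞ (i^{-2α}/(i^{-2α} + λ)) iᵖ ≤ C λ^{-(p+1)/(2α)}`. -/
theorem series_bound_polynomial_eigenvalues
    (p : ℕ) (α : ℝ) (hα : ((p : ℝ) + 1) / 2 < α) :
    ∃ C > (0 : ℝ), ∀ lam ∈ Set.Ioc (0 : ℝ) 1,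
      ∑' i : ℕ, ENNReal.ofReal
          (((i : ℝ) + 1) ^ (-(2 * α)) /
              (((i : ℝ) + 1) ^ (-(2 * α)) + lam) * ((i : ℝ) + 1) ^ p) ≤
        ENNReal.ofReal (C * lam ^ (-((p : ℝ) + 1) / (2 * α))) := by
  have hp0 : (0 : ℝ) ≤ p := by positivity
  have hα0 : 0 < 2 * α := by linarith
  let c : ℕ → ℝ := fun k ↦ (if k = 0 then (2 : ℝ) ^ p else 0) + (k : ℝ) ^ (-(2 * α - p))
  have hc0 (k : ℕ) : 0 ≤ c k := by
    dsimp only [c]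
    split_ifs <;> positivity
  have hc : Summable c :=
    (summable_of_ne_finset_zero (s := {0}) (by simp +contextual)).add
      (Real.summable_nat_rpow.2 (by linarith))
  have hS : 0 < ∑' k, c k := hc.tsum_pos hc0 0 (by
    have : (0 : ℝ) ≤ ((0 : ℕ) : ℝ) ^ (-(2 * α - p)) := by positivity
    dsimp only [c]
    rw [if_pos rfl]
    positivity)
  refine ⟨2 * ∑' k, c k, by positivity, fun lam ⟨hl0, hl1⟩ ↦ ?_⟩
  set N : ℝ := lam ^ (-1 / (2 * α)) with hNdef
  have hN : 1 ≤ N := Real.one_le_rpow_of_pos_of_le_one_of_nonpos hl0 hl1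
    (div_nonpos_of_nonpos_of_nonneg (by norm_num) hα0.le)
  have hNlam : N ^ (-(2 * α)) = lam := by
    rw [hNdef, ← Real.rpow_mul hl0.le, show -1 / (2 * α) * -(2 * α) = 1 by
      rw [mul_neg, div_mul_cancel₀ _ hα0.ne', neg_neg],
      Real.rpow_one]
  have hNp : lam ^ (-((p : ℝ) + 1) / (2 * α)) = N ^ (p + 1) := by
    rw [hNdef, ← Real.rpow_natCast, ← Real.rpow_mul hl0.le]
    congr 1
    push_cast
    ring
  obtain ⟨M, hNM, hMN⟩ : ∃ M : ℕ, N ≤ M ∧ (M : ℝ) ≤ 2 * N :=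
    ⟨⌈N⌉₊, Nat.le_ceil N, by linarith [Nat.ceil_lt_add_one (by linarith : 0 ≤ N)]⟩
  have hM : M ≠ 0 := by
    rintro rfl
    norm_num at hNM
    linarith
  have : NeZero M := ⟨hM⟩
  rw [← (Nat.divModEquiv M).symm.tsum_eq, ENNReal.tsum_prod', hNp]
  calc _ ≤ ∑' (k : ℕ) (_ : Fin M), ENNReal.ofReal (N ^ p * c k) := by
        refine ENNReal.tsum_le_tsum fun k ↦ ENNReal.tsum_le_tsum fun r ↦
          ENNReal.ofReal_le_ofReal ?_
        have := regularized_power_term_le p (α := α) (by linarith) hN hNM hMN k r r.isLt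
        rw [hNlam] at this
        exact this
    _ = ENNReal.ofReal (M * (N ^ p * ∑' k, c k)) := by
        simp only [tsum_fintype, Finset.sum_const, Finset.card_univ, Fintype.card_fin,
          nsmul_eq_mul]
        rw [ENNReal.tsum_mul_left, ← ENNReal.ofReal_tsum_of_nonneg
          (fun k ↦ mul_nonneg (by positivity) (hc0 k)) (hc.mul_left _), tsum_mul_left,
          ENNReal.ofReal_mul (by positivity : (0 : ℝ) ≤ M), ENNReal.ofReal_natCast]
    _ ≤ _ := by
        refine ENNReal.ofReal_le_ofReal ?_
        calc (M : ℝ) * (N ^ p * ∑' k, c k) ≤ 2 * N * (N ^ p * ∑' k, c k) := by gcongr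
          _ = _ := by ring
end

section
/- Let c < t < d be real numbers and let G : ℝ → ℝ be twice continuously differentiable on (c,d) with G″(x) > 0 for all x ∈ (c,t) and G″(x) < 0 for all x ∈ (t,d). Then there exists ε > 0 such that every function F : ℝ → ℝ that is twice differentiable on (c,d) and satisfies |F(x) − G(x)| ≤ ε for all x ∈ (c,d) has a point s ∈ (c,d) with F″(s) = 0. -/
/-- A function with positive second derivative on an interval cannot be uniformly approximated
by functions with negative second derivative there. -/
lemma exists_pos_forall_not_deriv2_neg_of_deriv2_pos {a b : ℝ} (hab : a < b) {G : ℝ → ℝ}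
    (hG : ContinuousOn G (Set.Ioo a b)) (hpos : ∀ x ∈ Set.Ioo a b, 0 < deriv (deriv G) x) :
    ∃ ε > (0 : ℝ), ∀ F : ℝ → ℝ, ContinuousOn F (Set.Ioo a b) →
      (∀ x ∈ Set.Ioo a b, |F x - G x| ≤ ε) →
      ¬ ∀ x ∈ Set.Ioo a b, deriv (deriv F) x < 0 := by
  have hp : (3 * a + b) / 4 ∈ Set.Ioo a b := ⟨by linarith, by linarith⟩
  have hq : (a + 3 * b) / 4 ∈ Set.Ioo a b := ⟨by linarith, by linarith⟩
  have hm : (a + b) / 2 ∈ Set.Ioo a b := ⟨by linarith, by linarith⟩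
  have hpq : (3 * a + b) / 4 ≠ (a + 3 * b) / 4 := by intro h; linarith
  have hmid : (1 / 2 : ℝ) • ((3 * a + b) / 4) + (1 / 2 : ℝ) • ((a + 3 * b) / 4) = (a + b) / 2 := by
    simp only [smul_eq_mul]; ring
  have hconv : StrictConvexOn ℝ (Set.Ioo a b) G :=
    strictConvexOn_of_deriv2_pos' (convex_Ioo a b) hG hpos
  have hgap := hconv.2 hp hq hpq one_half_pos one_half_pos (add_halves 1)
  rw [hmid] at hgap
  simp only [smul_eq_mul] at hgap
  refine ⟨(1 / 2 * G ((3 * a + b) / 4) + 1 / 2 * G ((a + 3 * b) / 4) - G ((a + b) / 2)) / 4,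
    by linarith, fun F hF hFG hneg => ?_⟩
  have hconc : StrictConcaveOn ℝ (Set.Ioo a b) F :=
    strictConcaveOn_of_deriv2_neg' (convex_Ioo a b) hF hneg
  have hgapF := hconc.2 hp hq hpq one_half_pos one_half_pos (add_halves 1)
  rw [hmid] at hgapF
  simp only [smul_eq_mul] at hgapF
  have h₁ := abs_le.1 (hFG _ hp)
  have h₂ := abs_le.1 (hFG _ hq)
  have h₃ := abs_le.1 (hFG _ hm)
  linarith

/-- Deterministic engine of Steps 1 and 4 of Theorem 3(i): if `G` is twice continuously
differentiable on `(c,d)` with `G'' > 0` on `(c,t)` and `G'' < 0` on `(t,d)` for some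
`c < t < d`, then there is `ε > 0` such that every `F` twice differentiable on `(c,d)`
and uniformly `ε`-close to `G` on `(c,d)` has a point `s ∈ (c,d)` with `F''(s) = 0`. -/
theorem inflection_point_of_uniform_approximation
    (c t d : ℝ) (hct : c < t) (htd : t < d) (G : ℝ → ℝ)
    (hG : ContDiffOn ℝ 2 G (Set.Ioo c d))
    (hpos : ∀ x ∈ Set.Ioo c t, 0 < deriv (deriv G) x)
    (hneg : ∀ x ∈ Set.Ioo t d, deriv (deriv G) x < 0) :
    ∃ ε > (0 : ℝ), ∀ F : ℝ → ℝ,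
      (∀ x ∈ Set.Ioo c d, DifferentiableAt ℝ F x) →
      (∀ x ∈ Set.Ioo c d, DifferentiableAt ℝ (deriv F) x) →
      (∀ x ∈ Set.Ioo c d, |F x - G x| ≤ ε) →
      ∃ s ∈ Set.Ioo c d, deriv (deriv F) s = 0 := by
  have hleft : Set.Ioo c t ⊆ Set.Ioo c d := Set.Ioo_subset_Ioo_right htd.le
  have hright : Set.Ioo t d ⊆ Set.Ioo c d := Set.Ioo_subset_Ioo_left hct.le
  obtain ⟨ε₁, hε₁, h₁⟩ := exists_pos_forall_not_deriv2_neg_of_deriv2_pos hct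
    (hG.continuousOn.mono hleft) hpos
  obtain ⟨ε₂, hε₂, h₂⟩ := exists_pos_forall_not_deriv2_neg_of_deriv2_pos (G := -G) htd
    (hG.continuousOn.mono hright).neg (by simpa [deriv.neg'] using hneg)
  refine ⟨min ε₁ ε₂, lt_min hε₁ hε₂, fun F hF hF' hFG => ?_⟩
  have hFc : ContinuousOn F (Set.Ioo c d) := fun x hx => (hF x hx).continuousAt.continuousWithinAt
  by_contra! hne
  rcases hasDerivWithinAt_forall_lt_or_forall_gt_of_forall_ne (convex_Ioo c d)
    (fun x hx => (hF' x hx).hasDerivAt.hasDerivWithinAt) hne with h | h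
  · exact h₁ F (hFc.mono hleft) (fun x hx => (hFG x (hleft hx)).trans (min_le_left _ _))
      fun x hx => h x (hleft hx)
  · refine h₂ (-F) (hFc.mono hright).neg (fun x hx => ?_) fun x hx => ?_
    · rw [Pi.neg_apply, Pi.neg_apply, neg_sub_neg, abs_sub_comm]
      exact (hFG x (hright hx)).trans (min_le_right _ _)
    · simpa [deriv.neg'] using h x (hright hx)
end
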